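/- Let X be a Hausdorff topological space that is locally compact, connected, admits at least one continuous weak selection, and is a king space. Then X is compact. -/

import Mathlib

/-- A weak selection on `X`, encoded as a symmetric function `φ : X → X → X`
with `φ a b ∈ {a, b}` for all `a b`. -/
def IsWeakSelection {X : Type*} (φ : X → X → X) : Prop :=
  (∀ a b : X, φ a b = φ b a) ∧ (∀ a b : X, φ a b = a ∨ φ a b = b)

/-- `a →_φ b` : either `a = b`, or `a ≠ b` and `φ {a,b} = b`. -/
def SelArrow {X : Type*} (φ : X → X → X) (a b : X) : Prop :=
  a = b ∨ (a ≠ b ∧ φ a b = b)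

/-- `z` is a `φ`-king: for every `x` there is `y` with `z →_φ y →_φ x`. -/
def IsKing {X : Type*} (φ : X → X → X) (z : X) : Prop :=
  ∀ x : X, ∃ y : X, SelArrow φ z y ∧ SelArrow φ y x

/-- Continuity of a weak selection `φ` on a topological space `X`. -/
def ContWeakSel {X : Type*} [TopologicalSpace X] (φ : X → X → X) : Prop :=
  ∀ a b : X, a ≠ b → ∀ W : Set X, IsOpen W → φ a b ∈ W →
    ∃ U V : Set X, IsOpen U ∧ IsOpen V ∧ a ∈ U ∧ b ∈ V ∧
      ∀ a' ∈ U, ∀ b' ∈ V, a' ≠ b' → φ a' b' ∈ W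

/-- A king space: every continuous weak selection has a king. -/
def IsKingSpace (X : Type*) [TopologicalSpace X] : Prop :=
  ∀ φ : X → X → X, IsWeakSelection φ → ContWeakSel φ → ∃ z : X, IsKing φ z

open Set Topology Filter

section LinearOrder

variable {X : Type*} [TopologicalSpace X] [LinearOrder X]

theorem compactSpace_of_isBot_isTop [PreconnectedSpace X]
    (hconv : ∀ p : X, ∀ U ∈ 𝓝 p, ∃ V ∈ 𝓝 p, V.OrdConnected ∧ V ⊆ U)
    {b t : X} (hb : IsBot b) (ht : IsTop t) : CompactSpace X := by
  refine ⟨isCompact_iff_ultrafilter_le_nhds.2 fun f _ => ?_⟩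
  by_contra! hf
  have hloc : ∀ p : X, ∃ V ∈ 𝓝 p, V.OrdConnected ∧ V ∉ f := fun p => by
    obtain ⟨U, hU, hUf⟩ := not_forall₂.1 (hf p (mem_univ p))
    obtain ⟨V, hV, hVc, hVU⟩ := hconv p U hU
    exact ⟨V, hV, hVc, fun h => hUf (mem_of_superset h hVU)⟩
  have key : ∀ V : Set X, V.OrdConnected → V ∉ f → ∀ y ∈ V, ∀ z ∈ V, Iic y ∈ f → Iic z ∈ f := by
    intro V hVc hVf y hy z hz hyf
    have : Iic z ∪ V ∈ f := mem_of_superset hyf fun w hw => by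
      rcases le_or_gt w z with h | h
      · exact Or.inl h
      · exact Or.inr (hVc.out hz hy ⟨h.le, hw⟩)
    exact (Ultrafilter.union_mem_iff.1 this).resolve_right hVf
  have hS : IsClopen {x : X | Iic x ∈ f} := by
    constructor
    · refine isOpen_compl_iff.1 (isOpen_iff_mem_nhds.2 fun p hp => ?_)
      obtain ⟨V, hV, hVc, hVf⟩ := hloc p
      exact mem_of_superset hV fun y hy h => hp (key V hVc hVf y hy p (mem_of_mem_nhds hV) h)
    · refine isOpen_iff_mem_nhds.2 fun p hp => ?_
      obtain ⟨V, hV, hVc, hVf⟩ := hloc p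
      exact mem_of_superset hV fun y hy => key V hVc hVf p (mem_of_mem_nhds hV) y hy hp
  have hbS : b ∈ {x : X | Iic x ∈ f} := by
    rw [hS.eq_univ ⟨t, mem_of_superset univ_mem fun x _ => ht x⟩]
    exact mem_univ b
  obtain ⟨V, hV, -, hVf⟩ := hloc b
  refine hVf (mem_of_superset hbS fun x hx => ?_)
  rw [le_antisymm hx (hb x)]
  exact mem_of_mem_nhds hV

variable [OrderClosedTopology X]

theorem isPreconnected_uIcc_of_preconnectedSpace [PreconnectedSpace X] (a b : X) :
    IsPreconnected (uIcc a b) := by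
  have hcont : Continuous fun x : X => max (a ⊓ b) (min (a ⊔ b) x) := by fun_prop
  convert isPreconnected_range hcont
  ext x
  constructor
  · rintro ⟨h₁, h₂⟩
    exact ⟨x, by simp only [min_eq_right h₂, max_eq_right h₁]⟩
  · rintro ⟨y, rfl⟩
    exact ⟨le_max_left _ _, max_le inf_le_sup (min_le_left _ _)⟩

theorem IsCompact.exists_isOpen_isLowerSet_notMem {B : Set X} (hB : IsCompact B) {p : X}
    (hp : p ∉ B) : ∃ R, IsOpen R ∧ IsLowerSet R ∧ p ∈ R ∧ ∀ b ∈ B, p ≤ b → b ∉ R := by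
  rcases (B ∩ Ici p).eq_empty_or_nonempty with h | h
  · refine ⟨univ, isOpen_univ, isLowerSet_univ, mem_univ p, fun b hb hpb _ => ?_⟩
    exact (h ▸ ⟨hb, hpb⟩ : b ∈ (∅ : Set X))
  · obtain ⟨m, ⟨hmB, hpm⟩, hm⟩ := (hB.inter_right isClosed_Ici).exists_isLeast h
    exact ⟨Iio m, isOpen_Iio, isLowerSet_Iio m,
      lt_of_le_of_ne hpm fun h => hp (h ▸ hmB),
      fun b hb hpb hbm => (hm ⟨hb, hpb⟩).not_gt hbm⟩

theorem IsCompact.exists_isOpen_ordConnected_disjoint {B : Set X} (hB : IsCompact B) {p : X}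
    (hp : p ∉ B) : ∃ V, IsOpen V ∧ V.OrdConnected ∧ p ∈ V ∧ Disjoint V B := by
  obtain ⟨R, hR, hRl, hpR, hRB⟩ := hB.exists_isOpen_isLowerSet_notMem hp
  obtain ⟨L, hL, hLu, hpL, hLB⟩ := IsCompact.exists_isOpen_isLowerSet_notMem (X := Xᵒᵈ) hB hp
  have hLu' : IsUpperSet (α := X) L := hLu
  refine ⟨R ∩ L, hR.inter hL, hRl.ordConnected.inter hLu'.ordConnected, ⟨hpR, hpL⟩,
    disjoint_left.2 ?_⟩
  rintro b ⟨hbR, hbL⟩ hb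
  rcases le_total p b with h | h
  · exact hRB b hb h hbR
  · exact hLB b hb h hbL

/-- A connected, locally compact, weakly ordered space is locally order-convex. -/
theorem exists_mem_nhds_ordConnected_subset [PreconnectedSpace X] [LocallyCompactSpace X]
    {p : X} {U : Set X} (hU : U ∈ 𝓝 p) : ∃ V ∈ 𝓝 p, V.OrdConnected ∧ V ⊆ U := by
  obtain ⟨K, hK, hKU, hKc⟩ := local_compact_nhds hU
  have hfr := hKc.isClosed.frontier_eq
  have hpK : p ∈ interior K := mem_interior_iff_mem_nhds.2 hK
  obtain ⟨V, hV, hVc, hpV, hVK⟩ :=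
    (hKc.of_isClosed_subset isClosed_frontier hKc.isClosed.frontier_subset
      ).exists_isOpen_ordConnected_disjoint (p := p) (by rw [hfr]; exact fun h => h.2 hpK)
  refine ⟨V, hV.mem_nhds hpV, hVc, fun y hy => hKU (interior_subset ?_)⟩
  refine (isPreconnected_uIcc_of_preconnectedSpace p y).subset_left_of_subset_union
    isOpen_interior hKc.isClosed.isOpen_compl
    (disjoint_compl_right.mono_left interior_subset) (fun z hz => ?_)
    ⟨p, left_mem_uIcc, hpK⟩ right_mem_uIcc
  by_contra hz'
  simp only [mem_union, mem_compl_iff, not_or, not_not] at hz'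
  exact disjoint_left.1 hVK (hVc.uIcc_subset hpV hy hz) (hfr ▸ ⟨hz'.2, hz'.1⟩)

end LinearOrder

section WeakSelection

theorem IsWeakSelection.self {X : Type*} {φ : X → X → X} (hφ : IsWeakSelection φ) (a : X) : φ a a = a :=
  (hφ.2 a a).elim id id

variable {X : Type*} [TopologicalSpace X] {φ : X → X → X}

theorem contWeakSel_of_continuous (h : Continuous fun p : X × X => φ p.1 p.2) :
    ContWeakSel φ := by
  intro a b _ W hW hab
  obtain ⟨U, V, hU, hV, ha, hb, hUV⟩ := isOpen_prod_iff.1 (hW.preimage h) a b hab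
  exact ⟨U, V, hU, hV, ha, hb, fun a' ha' b' hb' _ => hUV (mk_mem_prod ha' hb')⟩

theorem IsKingSpace.exists_isTop [LinearOrder X] [OrderClosedTopology X] (h : IsKingSpace X) :
    ∃ t : X, IsTop t := by
  obtain ⟨z, hz⟩ := h min ⟨min_comm, min_choice⟩
    (contWeakSel_of_continuous (continuous_fst.min continuous_snd))
  have harrow : ∀ {a b : X}, SelArrow min a b → b ≤ a := by
    rintro a b (rfl | ⟨-, h⟩)
    exacts [le_rfl, min_eq_right_iff.1 h]
  exact ⟨z, fun x => let ⟨_, h₁, h₂⟩ := hz x; (harrow h₂).trans (harrow h₁)⟩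

theorem IsKingSpace.exists_isBot [LinearOrder X] [OrderClosedTopology X] (h : IsKingSpace X) :
    ∃ b : X, IsBot b :=
  IsKingSpace.exists_isTop (X := Xᵒᵈ) h

/-- A continuous weak selection is separately continuous. -/
theorem ContWeakSel.continuous_left [T1Space X] (hc : ContWeakSel φ) (hφ : IsWeakSelection φ)
    (b : X) : Continuous fun a => φ a b := by
  refine continuous_iff_continuousAt.2 fun a => ?_
  refine (nhds_basis_opens _).tendsto_right_iff.2 ?_
  rintro W ⟨haW, hW⟩
  by_cases hab : a = b
  · subst hab
    replace haW : a ∈ W := hφ.self a ▸ haW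
    filter_upwards [hW.mem_nhds haW] with y hy
    rcases hφ.2 y a with h | h <;> rwa [h]
  · obtain ⟨U, V, hU, -, haU, hbV, h⟩ := hc a b hab W hW haW
    filter_upwards [hU.mem_nhds haU, isOpen_ne.mem_nhds hab] with y hy hyb
    exact h y hy b hbV hyb

/-- Points at which a continuous weak selection chooses the second one are stable. -/
theorem ContWeakSel.exists_isOpen_eq_right [T2Space X] (hc : ContWeakSel φ)
    (hφ : IsWeakSelection φ) {a b : X} (hab : a ≠ b) (h : φ a b = b) :
    ∃ U V : Set X, IsOpen U ∧ IsOpen V ∧ a ∈ U ∧ b ∈ V ∧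
      ∀ a' ∈ U, ∀ b' ∈ V, a' ≠ b' ∧ φ a' b' = b' := by
  obtain ⟨A, B, hA, hB, haA, hbB, hAB⟩ := t2_separation hab
  obtain ⟨U, V, hU, hV, haU, hbV, hUV⟩ := hc a b hab B hB (h.symm ▸ hbB)
  refine ⟨U ∩ A, V ∩ B, hU.inter hA, hV.inter hB, ⟨haU, haA⟩, ⟨hbV, hbB⟩, ?_⟩
  rintro a' ⟨ha'U, ha'A⟩ b' ⟨hb'V, hb'B⟩
  have hne : a' ≠ b' := fun h => disjoint_left.1 hAB ha'A (h ▸ hb'B)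
  refine ⟨hne, (hφ.2 a' b').resolve_left fun h => ?_⟩
  exact disjoint_left.1 hAB ha'A (h ▸ hUV a' ha'U b' hb'V hne)

theorem ContWeakSel.isOpen_setOf_lt [T2Space X] (hc : ContWeakSel φ) (hφ : IsWeakSelection φ) :
    IsOpen {p : X × X | p.1 ≠ p.2 ∧ φ p.1 p.2 = p.2} := by
  refine isOpen_prod_iff.2 fun a b ⟨hab, h⟩ => ?_
  obtain ⟨U, V, hU, hV, ha, hb, hUV⟩ := hc.exists_isOpen_eq_right hφ hab h
  exact ⟨U, V, hU, hV, ha, hb, fun p hp => hUV p.1 hp.1 p.2 hp.2⟩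

/-- On a connected Hausdorff space, the relation of a continuous weak selection is transitive. -/
theorem ContWeakSel.trans [T2Space X] [PreconnectedSpace X] (hc : ContWeakSel φ)
    (hφ : IsWeakSelection φ) {a b c : X} (hab : φ a b = a) (hbc : φ b c = b) : φ a c = a := by
  by_contra hac
  have hca : φ a c = c := (hφ.2 a c).resolve_left hac
  have hne : a ≠ c := by
    rintro rfl
    exact hac hca
  have hbc' : c ≠ b := by
    rintro rfl
    exact hac hab
  have ho := hc.isOpen_setOf_lt hφ
  have hsub : range (fun x => φ x b) ⊆ {x | c ≠ x ∧ φ c x = x} := by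
    refine (isPreconnected_range (hc.continuous_left hφ b)).subset_left_of_subset_union
      (v := {x | x ≠ c ∧ φ x c = c}) (ho.preimage (by fun_prop : Continuous fun x => (c, x)))
      (ho.preimage (by fun_prop : Continuous fun x => (x, c))) ?_ ?_
      ⟨b, ⟨b, hφ.self b⟩, hbc', by rw [hφ.1, hbc]⟩
    · refine disjoint_left.2 fun x hx hx' => hx.1 ?_
      rw [← hx'.2, hφ.1, hx.2]
    · rintro _ ⟨x, rfl⟩
      have hxc : φ x b ≠ c := by
        intro h
        rcases hφ.2 x b with h' | h'
        · obtain rfl : x = c := h'.symm.trans h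
          exact hbc' (h.symm.trans ((hφ.1 x b).trans hbc))
        · exact hbc' (h.symm.trans h')
      rcases hφ.2 c (φ x b) with h | h
      · exact Or.inr ⟨hxc, by rw [hφ.1, h]⟩
      · exact Or.inl ⟨hxc.symm, h⟩
  have ha := (hsub ⟨a, hab⟩).2
  rw [hφ.1, hca] at ha
  exact hne ha.symm

/-- A connected Hausdorff space with a continuous weak selection is weakly orderable. -/
theorem ContWeakSel.exists_linearOrder [T2Space X] [PreconnectedSpace X] (hc : ContWeakSel φ)
    (hφ : IsWeakSelection φ) : ∃ _ : LinearOrder X, OrderClosedTopology X := by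
  classical
  let L : LinearOrder X :=
    { le := fun a b => φ a b = a
      le_refl := hφ.self
      le_trans := fun _ _ _ => hc.trans hφ
      le_antisymm := fun a b h h' => by rw [← h, hφ.1, h']
      le_total := fun a b => (hφ.2 a b).imp id fun h => by rw [hφ.1, h]
      toDecidableLE := Classical.decRel _ }
  refine ⟨L, ⟨isOpen_compl_iff.1 ?_⟩⟩
  convert hc.isOpen_setOf_lt hφ using 1
  ext ⟨a, b⟩
  change ¬ φ a b = a ↔ a ≠ b ∧ φ a b = b
  constructor
  · intro h
    refine ⟨?_, (hφ.2 a b).resolve_left h⟩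
    rintro rfl
    exact h (hφ.self a)
  · rintro ⟨hab, h⟩ h'
    exact hab (h'.symm.trans h)

end WeakSelection

/-- A locally compact connected Hausdorff king space having at least one
continuous weak selection is compact. -/
theorem locally_compact_connected_king_compact {X : Type*} [TopologicalSpace X]
    [T2Space X] [LocallyCompactSpace X] [ConnectedSpace X]
    (hsel : ∃ ψ : X → X → X, IsWeakSelection ψ ∧ ContWeakSel ψ)
    (hking : IsKingSpace X) :
    CompactSpace X := by
  obtain ⟨ψ, hψ, hc⟩ := hsel
  obtain ⟨_, _⟩ := hc.exists_linearOrder hψ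
  obtain ⟨t, ht⟩ := hking.exists_isTop
  obtain ⟨b, hb⟩ := hking.exists_isBot
  exact compactSpace_of_isBot_isTop (fun _ _ => exists_mem_nhds_ordConnected_subset) hb ht
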